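/- arXiv:1712.07723 — 7 statements merged into one kernel-verified Lean document; each statement's English description precedes it below -/
import Mathlib

section
/- Let p be an odd prime, e ≥ 1 an integer, and suppose either e is even or p ≡ 1 (mod 4). Let q = p^e. If n_1, n_2 ≥ 1 are integers with n_1 ≡ n_2 (mod p(p^{2e} − 1)/2), then the Fibonacci polynomials f_{n_1} and f_{n_2} induce the same function on 𝔽_q, i.e. f_{n_1}(x) = f_{n_2}(x) for all x ∈ 𝔽_q. -/
open Polynomial

/-- The Fibonacci polynomials over ℤ: `f 0 = 0`, `f 1 = 1`,
`f (n+2) = X * f (n+1) + f n`. -/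
noncomputable def fibPoly : ℕ → Polynomial ℤ
  | 0 => 0
  | 1 => 1
  | (n + 2) => X * fibPoly (n + 1) + fibPoly n

theorem sub_mul_aeval_fibPoly {K : Type*} [CommRing K] {a b : K} (hab : a * b = -1) (n : ℕ) :
    (a - b) * aeval (a + b) (fibPoly n) = a ^ n - b ^ n := by
  induction n using fibPoly.induct with
  | case1 => simp [fibPoly]
  | case2 => simp [fibPoly]
  | case3 n ih₁ ih₀ =>
    simp only [fibPoly, map_add, map_mul, aeval_X, Nat.succ_eq_add_one]
    linear_combination (a + b) * ih₁ + ih₀ + (a ^ n - b ^ n) * hab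

theorem mul_aeval_fibPoly_of_sq_eq_neg_one {K : Type*} [CommRing K] {a : K} (ha : a * a = -1)
    (n : ℕ) : a * aeval (a + a) (fibPoly n) = n * a ^ n := by
  induction n using fibPoly.induct with
  | case1 => simp [fibPoly]
  | case2 => simp [fibPoly]
  | case3 n ih₁ ih₀ =>
    simp only [fibPoly, map_add, map_mul, aeval_X, Nat.succ_eq_add_one]
    push_cast at ih₁ ⊢
    linear_combination (a + a) * ih₁ + ih₀ + n * a ^ n * ha

/-- A period of the powers of `a` and `b` gives one of the Fibonacci polynomials at `a + b`. -/
theorem aeval_fibPoly_periodic {K : Type*} [Field K] (p : ℕ) [CharP K p] {a b : K}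
    (hab : a * b = -1) {N : ℕ} (ha : a ^ N = 1) (hb : b ^ N = 1) :
    Function.Periodic (fun n => aeval (a + b) (fibPoly n)) (p * N) := by
  intro n
  have ha' : a ^ (n + p * N) = a ^ n := by rw [pow_add, mul_comm p, pow_mul, ha]; simp
  have hb' : b ^ (n + p * N) = b ^ n := by rw [pow_add, mul_comm p, pow_mul, hb]; simp
  dsimp only
  by_cases h : a = b
  · subst h
    have ha0 : a ≠ 0 := by rintro rfl; simp at hab
    apply mul_left_cancel₀ ha0
    rw [mul_aeval_fibPoly_of_sq_eq_neg_one hab, mul_aeval_fibPoly_of_sq_eq_neg_one hab, ha']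
    simp
  · apply mul_left_cancel₀ (sub_ne_zero.mpr h)
    rw [sub_mul_aeval_fibPoly hab, sub_mul_aeval_fibPoly hab, ha', hb']

/-- In an extension of a finite field with `4 * k + 1` elements, a root of `T ^ 2 - x * T - 1` with
`x` in the base field is fixed by Frobenius or sent to the other root. -/
theorem pow_eq_one_of_add_mem_finiteField {F K : Type*} [Field F] [Fintype F] [Field K]
    [Algebra F K] {k : ℕ} (hq : Fintype.card F = 4 * k + 1) {x : F} {a b : K}
    (hx : a + b = algebraMap F K x) (hab : a * b = -1) :
    a ^ (4 * k * (2 * k + 1)) = 1 := by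
  have ha0 : a ≠ 0 := by rintro rfl; simp at hab
  have hroot : a ^ 2 = algebraMap F K x * a + 1 := by rw [← hx]; linear_combination -hab
  have hfrob := congrArg (FiniteField.frobeniusAlgHom F K) hroot
  simp only [map_add, map_mul, map_pow, map_one, AlgHom.commutes,
    FiniteField.frobeniusAlgHom_apply, hq] at hfrob
  have hprod : (a ^ (4 * k + 1) - a) * (a ^ (4 * k + 1) - b) = 0 := by
    rw [← hx] at hfrob
    linear_combination hfrob + hab
  rcases mul_eq_zero.mp hprod with h | h
  · have h1 : a ^ (4 * k) = 1 := by
      apply mul_left_cancel₀ ha0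
      linear_combination h
    rw [pow_mul, h1, one_pow]
  · have h1 : a ^ (2 * (2 * k + 1)) = -1 := by
      linear_combination a * h + hab
    rw [show 4 * k * (2 * k + 1) = 2 * (2 * k + 1) * (2 * k) by ring, pow_mul, h1, pow_mul]
    simp

theorem pow_mod_four_eq_one {p e : ℕ} (hodd : Odd p) (hcase : Even e ∨ p % 4 = 1) :
    p ^ e % 4 = 1 := by
  rcases hcase with ⟨m, rfl⟩ | h
  · obtain ⟨k, rfl⟩ := hodd
    rw [← two_mul, pow_mul, Nat.pow_mod,
      show (2 * k + 1) ^ 2 = 4 * (k * k + k) + 1 by ring]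
    simp [Nat.add_mod]
  · rw [Nat.pow_mod, h]
    simp

theorem fibPoly_period_case1 (p e : ℕ) (hp : p.Prime) (hodd : Odd p) (he : 1 ≤ e)
    (hcase : Even e ∨ p % 4 = 1)
    (F : Type*) [Field F] [Fintype F] (hcard : Fintype.card F = p ^ e)
    (n₁ n₂ : ℕ) (hn₁ : 1 ≤ n₁) (hn₂ : 1 ≤ n₂)
    (hcong : n₁ ≡ n₂ [MOD p * (p ^ (2 * e) - 1) / 2]) (x : F) :
    Polynomial.aeval x (fibPoly n₁) = Polynomial.aeval x (fibPoly n₂) := by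
  have : Fact p.Prime := ⟨hp⟩
  have : CharP F p := charP_of_card_eq_prime_pow hcard
  let K := AlgebraicClosure F
  have : CharP K p := charP_of_injective_algebraMap (algebraMap F K).injective p
  obtain ⟨k, hk⟩ : ∃ k, p ^ e = 4 * k + 1 :=
    ⟨p ^ e / 4, by have := pow_mod_four_eq_one hodd hcase; omega⟩
  have hperiod : p * (p ^ (2 * e) - 1) / 2 = p * (4 * k * (2 * k + 1)) := by
    rw [mul_comm 2 e, pow_mul, hk,
      show (4 * k + 1) ^ 2 = 4 * k * (2 * k + 1) * 2 + 1 by ring, Nat.add_sub_cancel,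
      ← mul_assoc, Nat.mul_div_cancel _ two_pos]
  rw [hperiod] at hcong
  obtain ⟨a, ha⟩ := IsAlgClosed.exists_root
    (X ^ 2 - C (algebraMap F K x) * X - C 1 : K[X]) (by
      rw [show (X ^ 2 - C (algebraMap F K x) * X - C 1 : K[X]).degree = 2 by compute_degree!]
      simp)
  simp only [IsRoot, eval_sub, eval_pow, eval_X, eval_mul, eval_C] at ha
  obtain ⟨b, hb⟩ : ∃ b, a + b = algebraMap F K x := ⟨algebraMap F K x - a, by ring⟩
  have hab : a * b = -1 := by rw [← hb] at ha; linear_combination -ha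
  rw [hcard.symm] at hk
  have hper := aeval_fibPoly_periodic p hab (pow_eq_one_of_add_mem_finiteField hk hb hab)
    (pow_eq_one_of_add_mem_finiteField hk ((add_comm b a).trans hb) ((mul_comm b a).trans hab))
  apply (algebraMap F K).injective
  rw [← aeval_algebraMap_apply, ← aeval_algebraMap_apply, ← hb]
  have h₁ := hper.map_mod_nat n₁
  have h₂ := hper.map_mod_nat n₂
  rw [hcong] at h₁
  exact h₁.symm.trans h₂
end

section
/- Let e ≥ 1 be an integer and q = 2^e. If n_1, n_2 ≥ 1 are integers with n_1 ≡ n_2 (mod 2^{2e+1} − 2), then f_{n_1}(x) = f_{n_2}(x) for all x ∈ 𝔽_{2^e}. -/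
open Polynomial

theorem fibPoly_add_two (n : ℕ) :
    fibPoly (n + 2) = X * fibPoly (n + 1) + fibPoly n := by
  rw [fibPoly]

theorem fibPoly_add_add_one (m n : ℕ) :
    fibPoly (m + n + 1) = fibPoly m * fibPoly n + fibPoly (m + 1) * fibPoly (n + 1) := by
  induction m generalizing n with
  | zero => simp [fibPoly]
  | succ m ih =>
    rw [show m + 1 + n + 1 = m + (n + 1) + 1 by ring, ih, fibPoly_add_two, fibPoly_add_two]
    ring

section CommRing

variable {R : Type*} [CommRing R] {x : R}

theorem aeval_fibPoly_add_two (x : R) (n : ℕ) :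
    aeval x (fibPoly (n + 2)) = x * aeval x (fibPoly (n + 1)) + aeval x (fibPoly n) := by
  simp [fibPoly_add_two]

/-- If the sequence returns to its initial values after `p` steps, it has period `p`. -/
theorem periodic_aeval_fibPoly {p : ℕ} (h0 : aeval x (fibPoly p) = 0)
    (h1 : aeval x (fibPoly (p + 1)) = 1) :
    Function.Periodic (fun n => aeval x (fibPoly n)) p := by
  rintro (_ | n)
  · simpa [fibPoly] using h0
  · simp [add_right_comm n 1 p, fibPoly_add_add_one, h0, h1]

variable [CharP R 2]

theorem aeval_fibPoly_two_mul (x : R) (n : ℕ) :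
    aeval x (fibPoly (2 * n)) = x * aeval x (fibPoly n) ^ 2 := by
  cases n with
  | zero => simp [fibPoly]
  | succ m =>
    rw [show 2 * (m + 1) = m + (m + 1) + 1 by ring, fibPoly_add_add_one, map_add, map_mul,
      map_mul, aeval_fibPoly_add_two]
    linear_combination
      aeval x (fibPoly m) * aeval x (fibPoly (m + 1)) * CharTwo.two_eq_zero (R := R)

theorem mul_aeval_fibPoly_two_pow (x : R) (k : ℕ) :
    x * aeval x (fibPoly (2 ^ k)) = x ^ 2 ^ k := by
  induction k with
  | zero => simp [fibPoly]
  | succ k ih =>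
    rw [pow_succ' 2 k, aeval_fibPoly_two_mul, mul_comm 2, pow_mul, ← ih]
    ring

/-- Cassini's identity in characteristic two. -/
theorem aeval_fibPoly_cassini (x : R) (n : ℕ) :
    aeval x (fibPoly (n + 1)) ^ 2 + x * aeval x (fibPoly n) * aeval x (fibPoly (n + 1)) +
      aeval x (fibPoly n) ^ 2 = 1 := by
  induction n with
  | zero => simp [fibPoly]
  | succ n ih =>
    rw [aeval_fibPoly_add_two]
    linear_combination ih + (x ^ 2 * aeval x (fibPoly (n + 1)) ^ 2 +
      x * aeval x (fibPoly n) * aeval x (fibPoly (n + 1))) * CharTwo.two_eq_zero (R := R)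

end CommRing

theorem exists_dvd_periodic_aeval_fibPoly {F : Type*} [Field F] [Fintype F] [CharP F 2]
    {e : ℕ} (hcard : Fintype.card F = 2 ^ e) (x : F) :
    ∃ p, p ∣ 2 ^ (2 * e + 1) - 2 ∧ Function.Periodic (fun n => aeval x (fibPoly n)) p := by
  have hfac : 2 ^ (2 * e + 1) - 2 = 2 * ((2 ^ e + 1) * (2 ^ e - 1)) := by
    rw [← Nat.sq_sub_sq, one_pow, ← pow_mul, Nat.mul_sub, mul_comm e 2, pow_succ', mul_one]
  rw [hfac]
  rcases eq_or_ne x 0 with rfl | hx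
  · exact ⟨2, dvd_mul_right _ _, periodic_aeval_fibPoly (by simp [fibPoly]) (by simp [fibPoly])⟩
  have hq : aeval x (fibPoly (2 ^ e)) = 1 := by
    apply mul_left_cancel₀ hx
    rw [mul_aeval_fibPoly_two_pow, ← hcard, FiniteField.pow_card, mul_one]
  have hprod : aeval x (fibPoly (2 ^ e + 1)) * (aeval x (fibPoly (2 ^ e + 1)) + x) = 0 := by
    have h := aeval_fibPoly_cassini x (2 ^ e)
    rw [hq] at h
    linear_combination h
  rcases mul_eq_zero.mp hprod with h | h
  · refine ⟨2 ^ e + 1, (dvd_mul_right _ _).mul_left _, periodic_aeval_fibPoly h ?_⟩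
    rw [aeval_fibPoly_add_two, h, hq, mul_zero, zero_add]
  · obtain ⟨r, hr⟩ : ∃ r, 2 ^ e = r + 1 := Nat.exists_eq_add_one.mpr (by positivity)
    refine ⟨2 ^ e - 1, (dvd_mul_left _ _).mul_left _, ?_⟩
    rw [hr] at h hq ⊢
    rw [aeval_fibPoly_add_two, hq] at h
    refine periodic_aeval_fibPoly ?_ hq
    rw [Nat.add_sub_cancel]
    linear_combination h - x * CharTwo.two_eq_zero (R := F)

theorem fibPoly_period_char_two (e : ℕ) (he : 1 ≤ e)
    (F : Type*) [Field F] [Fintype F] (hcard : Fintype.card F = 2 ^ e)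
    (n₁ n₂ : ℕ) (hn₁ : 1 ≤ n₁) (hn₂ : 1 ≤ n₂)
    (hcong : n₁ ≡ n₂ [MOD 2 ^ (2 * e + 1) - 2]) (x : F) :
    Polynomial.aeval x (fibPoly n₁) = Polynomial.aeval x (fibPoly n₂) := by
  have : CharP F 2 := charP_of_card_eq_prime_pow hcard
  obtain ⟨p, hdvd, hp⟩ := exists_dvd_periodic_aeval_fibPoly hcard x
  have h : n₁ % p = n₂ % p := hcong.of_dvd hdvd
  have h₁ := hp.map_mod_nat n₁
  rw [h, hp.map_mod_nat] at h₁
  exact h₁.symm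
end

section
/- Let R be a commutative ring and let α, β ∈ R satisfy αβ = −1. Then for every integer n ≥ 0, (α − β) · f_n(α + β) = α^n − β^n, where f_n(α + β) denotes the evaluation of the Fibonacci polynomial f_n at α + β. -/
open Polynomial

theorem fibPoly_functional_expression {R : Type*} [CommRing R] (α β : R)
    (hab : α * β = -1) (n : ℕ) :
    (α - β) * Polynomial.aeval (α + β) (fibPoly n) = α ^ n - β ^ n := by
  induction n using Nat.twoStepInduction with
  | zero => simp [fibPoly]
  | one => simp [fibPoly]
  | more n ih₀ ih₁ =>
    simp only [fibPoly, map_add, map_mul, aeval_X]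
    linear_combination ih₀ + (α + β) * ih₁ + (α ^ n - β ^ n) * hab
end

section
/- Let R be a commutative ring and let b ∈ R satisfy b² = −1. Then for every integer n ≥ 0, the Fibonacci polynomial satisfies f_{n+1}(2b) = (n+1)·b^n, and likewise f_{n+1}(−2b) = (n+1)·(−b)^n. -/
open Polynomial

theorem aeval_two_mul_fibPoly_succ {R : Type*} [CommRing R] (b : R) (hb : b ^ 2 = -1) (n : ℕ) :
    aeval (2 * b) (fibPoly (n + 1)) = (n + 1 : ℕ) * b ^ n := by
  induction n using Nat.twoStepInduction with
  | zero => simp [fibPoly]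
  | one => simp [fibPoly]
  | more n ih₀ ih₁ =>
    rw [fibPoly, map_add, map_mul, aeval_X, ih₀, ih₁]
    push_cast
    linear_combination ((n : R) + 1) * b ^ n * hb

theorem fibPoly_eval_two_b {R : Type*} [CommRing R] (b : R) (hb : b ^ 2 = -1) (n : ℕ) :
    Polynomial.aeval (2 * b) (fibPoly (n + 1)) = (n + 1 : ℕ) * b ^ n ∧
      Polynomial.aeval (-(2 * b)) (fibPoly (n + 1)) = (n + 1 : ℕ) * (-b) ^ n := by
  refine ⟨aeval_two_mul_fibPoly_succ b hb n, ?_⟩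
  rw [← mul_neg]
  exact aeval_two_mul_fibPoly_succ (-b) (by rwa [neg_sq]) n
end

section
/- Let n be an integer with n ≡ 4 (mod 16) and n ≥ 20. Then the binomial coefficient C(n−6, 6) is odd, while the binomial coefficient C(n/2 + 6, n/2 − 6) is even. -/
/-- The lowest binary digit step of Lucas' theorem for the prime `2`. -/
theorem choose_mod_two_eq (n k : ℕ) :
    n.choose k % 2 = ((n % 2).choose (k % 2) * (n / 2).choose (k / 2)) % 2 :=
  haveI : Fact (Nat.Prime 2) := ⟨Nat.prime_two⟩
  Choose.choose_modEq_choose_mod_mul_choose_div_nat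

theorem odd_choose_six_of_mod_eight {m : ℕ} (hm : m % 8 = 6) : Odd (m.choose 6) := by
  rw [Nat.odd_iff, choose_mod_two_eq, show m % 2 = 0 by omega]
  norm_num
  rw [choose_mod_two_eq, show m / 2 % 2 = 1 by omega]
  norm_num
  rw [Nat.div_div_eq_div_mul]
  omega

theorem even_choose_twelve_of_eight_dvd {m : ℕ} (hm : 8 ∣ m) : Even (m.choose 12) := by
  rw [Nat.even_iff, choose_mod_two_eq, show m % 2 = 0 by omega]
  norm_num
  rw [choose_mod_two_eq, show m / 2 % 2 = 0 by omega]
  norm_num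
  rw [choose_mod_two_eq, Nat.div_div_eq_div_mul, show m / (2 * 2) % 2 = 0 by omega]
  norm_num

theorem binom_parity_four_mod_sixteen (n : ℕ) (hn : n % 16 = 4) (hn20 : 20 ≤ n) :
    Odd ((n - 6).choose 6) ∧ Even ((n / 2 + 6).choose (n / 2 - 6)) := by
  refine ⟨odd_choose_six_of_mod_eight (by omega), ?_⟩
  rw [Nat.choose_symm_of_eq_add (show n / 2 + 6 = (n / 2 - 6) + 12 by omega)]
  exact even_choose_twelve_of_eight_dvd (by omega)
end

section
/- Let p be a prime with p > 5 and let n ≥ 10 be an even integer with n ≡ 4 (mod p). Then the binomial coefficient C(n−5, 5) is not divisible by p, while the binomial coefficient C(n/2 + 5, n/2 − 5) is divisible by p. -/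
/-- The theorem of Lucas: a digit of `k` exceeding that of `n` in base `p` forces `p ∣ C(n, k)`. -/
theorem Nat.Prime.dvd_choose_of_mod_lt_mod {p n k : ℕ} (hp : p.Prime) (h : n % p < k % p) :
    p ∣ n.choose k := by
  have := Fact.mk hp
  have lucas := Choose.choose_modEq_choose_mod_mul_choose_div_nat (n := n) (k := k) (p := p)
  rw [Nat.choose_eq_zero_of_lt h, zero_mul] at lucas
  exact (Nat.modEq_zero_iff_dvd).1 lucas

/-- The theorem of Lucas for `k` with a single digit in base `p`. -/
theorem Nat.Prime.not_dvd_choose_of_le_mod {p n k : ℕ} (hp : p.Prime) (h : k ≤ n % p) :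
    ¬ p ∣ n.choose k := by
  have := Fact.mk hp
  have hlt : n % p < p := Nat.mod_lt _ hp.pos
  have hk : k < p := h.trans_lt hlt
  have lucas := Choose.choose_modEq_choose_mod_mul_choose_div_nat (n := n) (k := k) (p := p)
  rw [Nat.mod_eq_of_lt hk, Nat.div_eq_of_lt hk, Nat.choose_zero_right, mul_one] at lucas
  rw [lucas.dvd_iff dvd_rfl]
  intro hdvd
  have hfact : p ∣ (n % p).factorial := by
    rw [← Nat.choose_mul_factorial_mul_factorial h, mul_assoc]
    exact hdvd.mul_right _
  exact hlt.not_ge (hp.dvd_factorial.1 hfact)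

theorem binom_mod_p_four (p : ℕ) (hp : p.Prime) (hp5 : 5 < p)
    (n : ℕ) (hn : 10 ≤ n) (heven : Even n) (hmod : n % p = 4) :
    ¬ p ∣ (n - 5).choose 5 ∧ p ∣ (n / 2 + 5).choose (n / 2 - 5) := by
  have hdvd : p ∣ n - 4 := hmod ▸ Nat.dvd_sub_mod n
  constructor
  · apply hp.not_dvd_choose_of_le_mod
    have hsub : n - 5 + 1 ≡ 0 [MOD p] := by
      rw [Nat.modEq_zero_iff_dvd]
      convert hdvd using 1
      omega
    have hsucc : ((n - 5) % p + 1) % p = 0 := by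
      rw [Nat.mod_add_mod]
      exact hsub
    by_contra! hlt
    rw [Nat.mod_eq_of_lt (by omega)] at hsucc
    omega
  · obtain ⟨m, rfl⟩ := heven
    have hm : (m + m) / 2 = m := by omega
    have hdvd_half : p ∣ m - 2 := by
      have h2 : p ∣ 2 * (m - 2) := by
        convert hdvd using 1
        omega
      refine (hp.dvd_mul.1 h2).resolve_left fun h => ?_
      have := Nat.le_of_dvd two_pos h
      omega
    rw [hm, Nat.choose_symm_of_eq_add (show m + 5 = (m - 5) + 10 by omega)]
    apply hp.dvd_choose_of_mod_lt_mod
    obtain ⟨c, hc⟩ := hdvd_half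
    rw [show m + 5 = 7 + p * c by omega, Nat.add_mul_mod_self_left]
    rcases lt_or_ge 10 p with h | h
    · rw [Nat.mod_eq_of_lt h]
      exact (Nat.mod_le 7 p).trans_lt (by norm_num)
    · interval_cases p <;> revert hp <;> norm_num
end

section
/- Let p be a prime with p ≡ 3 (mod 4), let e ≥ 1 be odd, set q = p^e, and assume q > 3. For j ≥ 1 let d_j = Σ_{x ∈ 𝔽_q} f_j(x) ∈ 𝔽_q. For 1 ≤ k ≤ q² − q + 1 write k = α + βq with 0 ≤ α, β ≤ q − 1, and define b_k ∈ 𝔽_q by: b_k = (−1)^β·C(q−1, β) if α + β = q; b_k = 1 if α + β = 1; b_k = 0 otherwise. Then: (i) d_j = 0 for 1 ≤ j ≤ q − 1; (ii) d_j = −b_{j−(q−1)} for j = q and j = q + 1; (iii) d_j = −b_{j−(q−1)} − d_{j−(q+1)} for q + 2 ≤ j ≤ q² − (q + 2); (iv) d_{q²−(q+1)} = −b_{q²−q+1}; (v) d_j = 0 for q² − q ≤ j ≤ q² − 1. -/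
open Polynomial

/-- The generating function of the Fibonacci polynomials evaluated at `x` is `t / (1 - t² - x t)`. -/
theorem mk_aeval_fibPoly_mul {F : Type*} [Field F] (x : F) :
    PowerSeries.mk (fun j => aeval x (fibPoly j)) *
      (1 - PowerSeries.X ^ 2 - PowerSeries.C x * PowerSeries.X) = PowerSeries.X := by
  set G := PowerSeries.mk (fun j => aeval x (fibPoly j)) with hG
  have h : G * (1 - PowerSeries.X ^ 2 - PowerSeries.C x * PowerSeries.X) =
      G - G * PowerSeries.X * PowerSeries.X - PowerSeries.C x * (G * PowerSeries.X) := by ring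
  rw [h]
  ext n
  rcases n with _ | _ | n
  · simp [hG, fibPoly]
  · rw [map_sub, map_sub, PowerSeries.coeff_succ_mul_X, PowerSeries.coeff_C_mul,
      PowerSeries.coeff_succ_mul_X]
    simp [hG, fibPoly]
  · rw [map_sub, map_sub, PowerSeries.coeff_succ_mul_X, PowerSeries.coeff_C_mul,
      PowerSeries.coeff_succ_mul_X, PowerSeries.coeff_succ_mul_X]
    simp [hG, fibPoly, PowerSeries.coeff_X]

theorem sum_pow_card_sub_one (F : Type*) [Field F] [Fintype F] :
    ∑ x : F, x ^ (Fintype.card F - 1) = -1 := by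
  classical
  have hpos : Fintype.card F - 1 ≠ 0 := by
    have := Fintype.one_lt_card (α := F)
    omega
  have h (x : F) : x ^ (Fintype.card F - 1) = 1 - if x = 0 then 1 else 0 := by
    split_ifs with hx
    · simp [hx, hpos]
    · simp [FiniteField.pow_card_sub_one_eq_one x hx]
  simp [h]

/-- The first moments of the Fibonacci polynomials over `𝔽_q` have generating function
`-t ^ q / ((1 - t ^ (q - 1)) (1 + t ^ (q + 1)))`. -/
theorem mk_sum_aeval_fibPoly_mul (F : Type*) [Field F] [Fintype F] :
    PowerSeries.mk (fun j => ∑ x : F, aeval x (fibPoly j)) *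
      ((1 - PowerSeries.X ^ (Fintype.card F - 1)) * (1 + PowerSeries.X ^ (Fintype.card F + 1))) =
      -PowerSeries.X ^ Fintype.card F := by
  obtain ⟨p, hchar⟩ := CharP.exists F
  obtain ⟨e, hp, hcard⟩ := FiniteField.card F p
  have : Fact p.Prime := ⟨hp⟩
  have : CharP (PowerSeries F) p := charP_of_injective_ringHom PowerSeries.C_injective p
  have hq1 := Fintype.one_lt_card (α := F)
  set q := Fintype.card F with hq
  obtain ⟨r, hr⟩ : ∃ r, q = r + 1 := ⟨q - 1, by omega⟩
  set t : PowerSeries F := PowerSeries.X with ht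
  set u : PowerSeries F := 1 - t ^ 2 with hu
  have hD : PowerSeries.mk (fun j => ∑ x : F, aeval x (fibPoly j)) =
      ∑ x : F, PowerSeries.mk (fun j => aeval x (fibPoly j)) := by
    ext n
    simp
  have huq : u ^ q = 1 - t ^ (2 * q) := by
    rw [hu, hcard, sub_pow_expChar_pow, one_pow, pow_mul]
  have hM : (1 - t ^ (q - 1)) * (1 + t ^ (q + 1)) = u ^ q - u * t ^ r := by
    rw [huq, hu, hr, Nat.add_sub_cancel]
    ring
  have hx (x : F) : PowerSeries.mk (fun j => aeval x (fibPoly j)) * (u ^ q - u * t ^ r) =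
      t * ∑ i ∈ Finset.range q, u ^ i * t ^ (q - 1 - i) * PowerSeries.C (x ^ (q - 1 - i)) -
        t * t ^ r := by
    set c : PowerSeries F := PowerSeries.C x * t with hc
    have hcq : c ^ q = c * t ^ r := by
      rw [hc, mul_pow, ← map_pow, FiniteField.pow_card, hr]
      ring
    have hgeom := (Commute.all u c).geom_sum₂_mul q
    have hsum : ∑ i ∈ Finset.range q, u ^ i * t ^ (q - 1 - i) * PowerSeries.C (x ^ (q - 1 - i)) =
        ∑ i ∈ Finset.range q, u ^ i * c ^ (q - 1 - i) := by
      refine Finset.sum_congr rfl fun i _ => ?_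
      rw [hc, mul_pow, map_pow]
      ring
    have hG := mk_aeval_fibPoly_mul x
    rw [← ht, ← hu, ← hc] at hG
    rw [hsum]
    linear_combination (∑ i ∈ Finset.range q, u ^ i * c ^ (q - 1 - i) - t ^ r) * hG -
      PowerSeries.mk (fun j => aeval x (fibPoly j)) * (hgeom - hcq)
  rw [hD, hM, Finset.sum_mul, Finset.sum_congr rfl fun x _ => hx x, Finset.sum_sub_distrib,
    ← Finset.mul_sum, Finset.sum_comm, Finset.sum_const, Finset.card_univ, ← hq]
  simp_rw [← Finset.mul_sum, ← map_sum]
  have hzero : (q : PowerSeries F) = 0 := by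
    rw [hcard, Nat.cast_pow, CharP.cast_eq_zero, zero_pow e.pos.ne']
  rw [nsmul_eq_mul, hzero, zero_mul, sub_zero, Finset.sum_eq_single 0]
  · rw [Nat.sub_zero, sum_pow_card_sub_one, hr, Nat.add_sub_cancel, map_neg, map_one]
    ring
  · intro i hi hi0
    rw [FiniteField.sum_pow_lt_card_sub_one, map_zero, mul_zero]
    rw [Finset.mem_range] at hi
    omega
  · intro h
    simp at h
    omega

theorem neg_one_pow_mul_choose_prime_pow_sub_one {R : Type*} [CommRing R] {p : ℕ} [CharP R p]
    (hp : p.Prime) (e : ℕ) {k : ℕ} (hk : k < p ^ e) :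
    (-1 : R) ^ k * ((p ^ e - 1).choose k : R) = 1 := by
  induction k with
  | zero => simp
  | succ k ih =>
    have hsucc : p ^ e - 1 + 1 = p ^ e := by omega
    have hpascal := Nat.choose_succ_succ (p ^ e - 1) k
    rw [Nat.succ_eq_add_one, Nat.succ_eq_add_one, hsucc] at hpascal
    have hdvd : p ∣ (p ^ e).choose (k + 1) := hp.dvd_choose_pow (by omega) (by omega)
    have h0 := (CharP.cast_eq_zero_iff R p _).2 hdvd
    rw [hpascal, Nat.cast_add] at h0
    have ih := ih (by omega)
    rw [pow_succ]
    linear_combination ih - (-1) ^ k * h0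

/-- `-t ^ q / ((1 - t ^ (q - 1)) (1 + t ^ (q + 1)))` satisfies an explicit linear recursion. -/
theorem coeff_add_coeff_of_mul_eq {R : Type*} [CommRing R] {q : ℕ} (hq : 1 < q) {D : PowerSeries R}
    (hD : D * ((1 - PowerSeries.X ^ (q - 1)) * (1 + PowerSeries.X ^ (q + 1))) =
      -PowerSeries.X ^ q) (j : ℕ) :
    D.coeff j + (if q + 1 ≤ j then D.coeff (j - (q + 1)) else 0) =
      if q ≤ j ∧ (q - 1) ∣ (j - 1) then -1 else 0 := by
  have hE : ∀ j, (D * (1 + PowerSeries.X ^ (q + 1))).coeff j =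
      D.coeff j + (if q + 1 ≤ j then D.coeff (j - (q + 1)) else 0) := by
    intro j
    rw [mul_add, mul_one, map_add, PowerSeries.coeff_mul_X_pow']
  rw [← hE]
  set E := D * (1 + PowerSeries.X ^ (q + 1))
  have hrec : ∀ j, E.coeff j - (if q - 1 ≤ j then E.coeff (j - (q - 1)) else 0) =
      if j = q then -1 else 0 := by
    intro j
    have h : E - E * PowerSeries.X ^ (q - 1) = -PowerSeries.X ^ q := by
      rw [← hD]
      ring
    have := congrArg (PowerSeries.coeff j) h
    rw [map_sub, PowerSeries.coeff_mul_X_pow', map_neg, PowerSeries.coeff_X_pow] at this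
    rw [this]
    split_ifs <;> simp
  induction j using Nat.strong_induction_on with
  | _ j ih =>
    rw [sub_eq_iff_eq_add.1 (hrec j)]
    by_cases hj : q - 1 ≤ j
    · rw [if_pos hj, ih _ (by omega)]
      rcases lt_trichotomy j q with h | rfl | h
      · rw [if_neg (by omega), if_neg (by omega), if_neg (by omega), add_zero]
      · rw [if_pos rfl, if_neg (by omega), if_pos ⟨le_rfl, dvd_rfl⟩, add_zero]
      · rw [if_neg (by omega), zero_add]
        have hiff : (q ≤ j - (q - 1) ∧ q - 1 ∣ j - (q - 1) - 1) ↔ (q ≤ j ∧ q - 1 ∣ j - 1) := by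
          have h1 : j - 1 = (j - (q - 1) - 1) + (q - 1) := by omega
          rw [h1, Nat.dvd_add_self_right]
          refine ⟨fun h => ⟨by omega, h.2⟩, fun h' => ⟨?_, h'.2⟩⟩
          have := Nat.le_of_dvd (by omega) h'.2
          omega
        simp only [hiff]
    · rw [if_neg hj, if_neg (by omega), if_neg (by omega), add_zero]

/-- For `q ≡ 3 mod 4`, `-t ^ q / ((1 - t ^ (q - 1)) (1 + t ^ (q + 1)))` is
`P / (1 - t ^ (q ^ 2 - 1))` with `-P` a monic polynomial of degree `q ^ 2 - q - 1`. -/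
theorem exists_monic_mul_one_sub_X_pow {R : Type*} [CommRing R] [IsDomain R] {q : ℕ}
    (hq : q % 4 = 3) {D : PowerSeries R}
    (hD : D * ((1 - PowerSeries.X ^ (q - 1)) * (1 + PowerSeries.X ^ (q + 1))) =
      -PowerSeries.X ^ q) :
    ∃ P : R[X], P.Monic ∧ P.natDegree = q ^ 2 - (q + 1) ∧
      D * (1 - PowerSeries.X ^ (q ^ 2 - 1)) = -(P : PowerSeries R) := by
  obtain ⟨n, rfl⟩ : ∃ n, q = 4 * n + 3 := ⟨q / 4, by omega⟩
  have e1 : 4 * n + 3 - 1 = 4 * n + 2 := by omega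
  have e2 : 4 * n + 3 + 1 = 4 * n + 4 := by omega
  rw [e1, e2] at hD
  set N := (4 * n + 2) * (2 * n + 2) with hN
  have hN' : N = (4 * n + 4) * (2 * n + 1) := by rw [hN]; ring
  have hNN : (4 * n + 3) ^ 2 - 1 = N + N := by
    have : (4 * n + 3) ^ 2 = N + N + 1 := by rw [hN]; ring
    omega
  obtain ⟨A, hA⟩ : (X ^ (4 * n + 2) - 1 : R[X]) ∣ X ^ N - 1 := by
    have := sub_dvd_pow_sub_pow (X ^ (4 * n + 2) : R[X]) 1 (2 * n + 2)
    rwa [one_pow, ← pow_mul] at this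
  obtain ⟨B, hB⟩ : (X ^ (4 * n + 4) + 1 : R[X]) ∣ X ^ N + 1 := by
    have := Odd.add_dvd_pow_add_pow (X ^ (4 * n + 4) : R[X]) 1 (n := 2 * n + 1) ⟨n, rfl⟩
    rwa [one_pow, ← pow_mul, ← hN'] at this
  have hN0 : N ≠ 0 := by rw [hN]; positivity
  have m1 : (X ^ (4 * n + 2) - 1 : R[X]).Monic := monic_X_pow_sub_C 1 (by omega)
  have m2 : (X ^ (4 * n + 4) + 1 : R[X]).Monic := monic_X_pow_add_C 1 (by omega)
  have m3 : (X ^ N - 1 : R[X]).Monic := monic_X_pow_sub_C 1 hN0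
  have m4 : (X ^ N + 1 : R[X]).Monic := monic_X_pow_add_C 1 hN0
  have d1 : (X ^ (4 * n + 2) - 1 : R[X]).natDegree = 4 * n + 2 :=
    natDegree_X_pow_sub_C (r := (1 : R))
  have d2 : (X ^ (4 * n + 4) + 1 : R[X]).natDegree = 4 * n + 4 :=
    natDegree_X_pow_add_C (r := (1 : R))
  have d3 : (X ^ N - 1 : R[X]).natDegree = N := natDegree_X_pow_sub_C (r := (1 : R))
  have d4 : (X ^ N + 1 : R[X]).natDegree = N := natDegree_X_pow_add_C (r := (1 : R))
  have mA : A.Monic := m1.of_mul_monic_left (hA ▸ m3)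
  have mB : B.Monic := m2.of_mul_monic_left (hB ▸ m4)
  refine ⟨X ^ (4 * n + 3) * (A * B), (monic_X_pow _).mul (mA.mul mB), ?_, ?_⟩
  · rw [(monic_X_pow _).natDegree_mul (mA.mul mB), mA.natDegree_mul mB, natDegree_X_pow]
    rw [hA, m1.natDegree_mul mA] at d3
    rw [hB, m2.natDegree_mul mB] at d4
    omega
  · have hA' := congrArg (fun P : R[X] => (P : PowerSeries R)) hA
    have hB' := congrArg (fun P : R[X] => (P : PowerSeries R)) hB
    push_cast at hA' hB' ⊢
    rw [hNN, pow_add]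
    linear_combination (A * B : PowerSeries R) * hD - D * (PowerSeries.X ^ N + 1) * hA' -
      D * (A * (PowerSeries.X ^ (4 * n + 2) - 1)) * hB'

/-- The base-`q` digit sum of `k ≤ q ^ 2 - q + 1` is `1` or `q` exactly when `k ≡ 1 mod q - 1`. -/
theorem mod_add_div_eq_or_iff_dvd {q k : ℕ} (hq : 2 < q) (hk1 : 1 ≤ k) (hk : k ≤ q ^ 2 - q + 1) :
    (k % q + k / q = q ∨ k % q + k / q = 1) ↔ (q - 1) ∣ (k - 1) := by
  have hdm := Nat.mod_add_div k q
  have hlt := Nat.mod_lt k (show 0 < q by omega)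
  have hdiv : k / q < q := by
    rw [Nat.div_lt_iff_lt_mul (by omega), ← sq]
    have : q ≤ q ^ 2 := Nat.le_self_pow (by omega) q
    omega
  generalize k % q = α at *
  generalize k / q = β at *
  obtain ⟨r, rfl⟩ : ∃ r, q = r + 1 := ⟨q - 1, by omega⟩
  have hpos : 1 ≤ α + β := by
    by_contra h
    have h1 : α = 0 := by omega
    have h2 : β = 0 := by omega
    rw [h1, h2] at hdm
    omega
  have hk' : k - 1 = (α + β - 1) + r * β := by
    have : (r + 1) * β = r * β + β := by ring
    omega
  rw [Nat.add_sub_cancel, hk', Nat.dvd_add_left (dvd_mul_right r β)]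
  constructor
  · rintro (h | h) <;> rw [h] <;> simp
  · rintro ⟨c, hc⟩
    have : c < 2 := by
      by_contra! h
      have := Nat.mul_le_mul_left r h
      omega
    interval_cases c <;> omega

/-- First-moment recursion for Fibonacci polynomials over `F = 𝔽_q`,
`q = p^e`, `p ≡ 3 (mod 4)`, `e` odd, `q > 3`.  For `1 ≤ k ≤ q² - q + 1`
the unique decomposition `k = α + βq` with `0 ≤ α, β ≤ q - 1` is given by
`α = k % q`, `β = k / q`. -/
theorem fibPoly_first_moment_case2 (p e : ℕ) (hp : p.Prime) (hp4 : p % 4 = 3)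
    (he : 1 ≤ e) (hodd : Odd e)
    (q : ℕ) (hq : q = p ^ e) (hq3 : 3 < q)
    (F : Type*) [Field F] [Fintype F] (hcard : Fintype.card F = q)
    (d : ℕ → F) (hd : ∀ j, d j = ∑ x : F, Polynomial.aeval x (fibPoly j))
    (b : ℕ → F)
    (hb : ∀ k, 1 ≤ k → k ≤ q ^ 2 - q + 1 →
      b k = if k % q + k / q = q then (-1 : F) ^ (k / q) * ((q - 1).choose (k / q) : F)
            else if k % q + k / q = 1 then 1 else 0) :
    (∀ j, 1 ≤ j → j ≤ q - 1 → d j = 0) ∧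
    (∀ j, q ≤ j → j ≤ q + 1 → d j = -b (j - (q - 1))) ∧
    (∀ j, q + 2 ≤ j → j ≤ q ^ 2 - (q + 2) → d j = -b (j - (q - 1)) - d (j - (q + 1))) ∧
    (d (q ^ 2 - (q + 1)) = -b (q ^ 2 - q + 1)) ∧
    (∀ j, q ^ 2 - q ≤ j → j ≤ q ^ 2 - 1 → d j = 0) := by
  have : Fact p.Prime := ⟨hp⟩
  have hchar : CharP F p := charP_of_card_eq_prime_pow (hcard.trans hq)
  have hq4 : q % 4 = 3 := by
    obtain ⟨m, rfl⟩ := hodd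
    have h9 : p ^ 2 % 4 = 1 := by rw [Nat.pow_mod, hp4]
    rw [hq, pow_succ, pow_mul, Nat.mul_mod, Nat.pow_mod, h9, hp4]
    simp
  have hD := mk_sum_aeval_fibPoly_mul F
  rw [hcard, ← funext hd] at hD
  have hrec := coeff_add_coeff_of_mul_eq (by omega) hD
  simp only [PowerSeries.coeff_mk] at hrec
  have hd0 : d 0 = 0 := by simp [hd, fibPoly]
  have hb' : ∀ k, 1 ≤ k → k ≤ q ^ 2 - q + 1 → b k = if (q - 1) ∣ (k - 1) then 1 else 0 := by
    intro k hk1 hk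
    rw [hb k hk1 hk, if_congr (mod_add_div_eq_or_iff_dvd (by omega) hk1 hk).symm rfl rfl]
    have hdiv : k / q < p ^ e := by
      rw [← hq, Nat.div_lt_iff_lt_mul (by omega), ← sq]
      have : q ≤ q ^ 2 := Nat.le_self_pow (by omega) q
      omega
    have hchoose := neg_one_pow_mul_choose_prime_pow_sub_one (R := F) hp e hdiv
    rw [← hq] at hchoose
    rw [hchoose]
    split_ifs <;> simp_all
  have hqq : 4 * q ≤ q ^ 2 := by nlinarith
  have hbrec : ∀ j, q ≤ j → j ≤ q ^ 2 →
      (if q ≤ j ∧ (q - 1) ∣ (j - 1) then (-1 : F) else 0) = -b (j - (q - 1)) := by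
    intro j hj hj'
    have h1 : j - 1 = (j - (q - 1) - 1) + (q - 1) := by omega
    rw [hb' _ (by omega) (by omega), h1]
    simp only [hj, true_and, Nat.dvd_add_self_right]
    split_ifs <;> simp
  obtain ⟨P, hP, hdeg, hDP⟩ := exists_monic_mul_one_sub_X_pow hq4 hD
  have hcoeff : ∀ j, d j - (if q ^ 2 - 1 ≤ j then d (j - (q ^ 2 - 1)) else 0) = -P.coeff j := by
    intro j
    have := congrArg (PowerSeries.coeff j) hDP
    rwa [mul_sub, mul_one, map_sub, PowerSeries.coeff_mul_X_pow', map_neg, coeff_coe,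
      PowerSeries.coeff_mk, PowerSeries.coeff_mk] at this
  refine ⟨fun j _ hj => ?_, fun j hj hj' => ?_, fun j hj hj' => ?_, ?_, fun j hj hj' => ?_⟩
  · have := hrec j
    rwa [if_neg (by omega), if_neg (by omega), add_zero] at this
  · rw [← hbrec j hj (by omega), ← hrec j]
    split_ifs with h
    · rw [show j - (q + 1) = 0 by omega, hd0, add_zero]
    · rw [add_zero]
  · rw [← hbrec j (by omega) (by omega), ← hrec j, if_pos (by omega)]
    ring
  · have := hcoeff (q ^ 2 - (q + 1))
    rw [if_neg (by omega), ← hdeg, hP.coeff_natDegree, hdeg, sub_zero] at this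
    have hdvd : q - 1 ∣ q ^ 2 - q + 1 - 1 := ⟨q, by rw [Nat.sub_mul]; simp [sq]⟩
    rw [this, hb' _ (by omega) le_rfl, if_pos hdvd]
  · have := hcoeff j
    rw [coeff_eq_zero_of_natDegree_lt (by omega), neg_zero, sub_eq_zero] at this
    rw [this]
    split_ifs with h
    · rw [show j - (q ^ 2 - 1) = 0 by omega, hd0]
    · rfl
end
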